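/- arXiv:2001.09123 — 7 statements merged into one kernel-verified Lean document; each statement's English description precedes it below -/
import Mathlib

section
/- Let p ∈ {3, 5} and let a ∈ ℝ^p be nonzero. Then for every v ∈ ℝ^p with pairwise distinct coordinates whose coordinates do not sum to 0, the hyperplane H = {x ∈ ℝ^p : Σ_m a_m x_m = 0} satisfies |H ∩ S_p·v| ≤ (p−1)!. -/
open Finset Equiv

/-- The permutations `σ` for which the arrangement of `a` given by `σ` is orthogonal to `v`. -/
noncomputable def orthogonalPerms {n : ℕ} (a v : Fin n → ℝ) : Finset (Perm (Fin n)) :=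
  univ.filter fun σ => ∑ i, a (σ i) * v i = 0

theorem mem_orthogonalPerms {n : ℕ} {a v : Fin n → ℝ} {σ : Perm (Fin n)} :
    σ ∈ orthogonalPerms a v ↔ ∑ i, a (σ i) * v i = 0 := by
  simp [orthogonalPerms]

theorem orthogonalPerms_neg {n : ℕ} (a v : Fin n → ℝ) :
    orthogonalPerms (-a) v = orthogonalPerms a v := by
  ext σ
  simp [mem_orthogonalPerms]

theorem card_orthogonalPerms_le_comp {n : ℕ} (a v : Fin n → ℝ) (ρ π : Perm (Fin n)) :
    (orthogonalPerms a v).card ≤ (orthogonalPerms (a ∘ ρ) (v ∘ π)).card := by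
  refine card_le_card_of_injOn (fun σ => ρ⁻¹ * σ * π) (fun σ hσ => ?_) (fun σ _ τ _ h => ?_)
  · rw [mem_coe, mem_orthogonalPerms] at hσ ⊢
    rw [← hσ, ← Equiv.sum_comp π fun i => a (σ i) * v i]
    simp
  · simpa using h

theorem ncard_orbit_inter_le {n : ℕ} (a v : Fin n → ℝ) :
    ({x : Fin n → ℝ | ∑ m, a m * x m = 0} ∩
      {w : Fin n → ℝ | ∃ σ : Perm (Fin n), w = fun m => v (σ⁻¹ m)}).ncard
      ≤ (orthogonalPerms a v).card := by
  classical
  refine le_trans (Set.ncard_le_ncard (t := ↑((orthogonalPerms a v).image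
    fun σ m => v (σ⁻¹ m))) ?_ (finite_toSet _)) ?_
  · rintro _ ⟨h, σ, rfl⟩
    rw [mem_coe, mem_image]
    refine ⟨σ, ?_, rfl⟩
    rw [Set.mem_ofPred_eq, ← Equiv.sum_comp σ] at h
    simpa [mem_orthogonalPerms] using h
  · rw [Set.ncard_coe_finset]
    exact card_image_le

/-- If a finite set is covered by families on each of which `F` is injective, then `F` takes a
given value on it at most as often as there are families. -/
theorem card_le_of_injective_cover {β R K M : Type*} [Fintype R] (F : β → M) (c : M)
    (g : R → K → β) (hg : ∀ r, Function.Injective (F ∘ g r)) (s : Finset β)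
    (hs : ∀ x ∈ s, F x = c ∧ ∃ r k, g r k = x) : s.card ≤ Fintype.card R := by
  have hcover : ∀ x : s, ∃ r k, g r k = x.1 := fun x => (hs x.1 x.2).2
  choose r k h using hcover
  rw [← Fintype.card_coe]
  refine Fintype.card_le_of_injective r fun x y hxy => Subtype.ext ?_
  have hk : k x = k y := by
    apply hg (r x)
    simp only [Function.comp_apply]
    rw [h x, hxy, h y, (hs x.1 x.2).1, (hs y.1 y.2).1]
  rw [← h x, ← h y, hxy, hk]

/-- Each colouring `q ∘ σ` arises from as many permutations as stabilise `q`. -/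
theorem card_perm_le_mul_card_colorings {n : ℕ} {κ : Type*} [DecidableEq κ] (q : Fin n → κ)
    (Z : Finset (Perm (Fin n))) :
    Z.card ≤ (univ.filter fun τ : Perm (Fin n) => q ∘ τ = q).card *
      (Z.image fun σ : Perm (Fin n) => q ∘ σ).card := by
  refine card_le_mul_card_image Z _ fun w hw => ?_
  obtain ⟨σ, -, rfl⟩ := mem_image.1 hw
  refine card_le_card_of_injOn (fun τ => τ * σ⁻¹) (fun τ hτ => ?_) (fun τ _ τ' _ h => ?_)
  · have h := (mem_filter.1 (mem_coe.1 hτ)).2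
    rw [mem_coe, mem_filter]
    refine ⟨mem_univ _, funext fun i => ?_⟩
    simpa using congrFun h (σ⁻¹ i)
  · simpa using h

theorem strictMono_insert {n : ℕ} {v : Fin (n + 1) → ℝ} (hv : StrictMono v) {b : Fin n → ℝ}
    {M : ℝ} (hb : ∀ j, b j < M) :
    StrictMono fun k : Fin (n + 1) => M * v k + ∑ j, b j * v (k.succAbove j) := by
  intro k l hkl
  have key : ∀ k : Fin (n + 1), M * v k + ∑ j, b j * v (k.succAbove j) =
      M * ∑ i, v i - ∑ j, (M - b j) * v (k.succAbove j) := by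
    intro k
    rw [Fin.sum_univ_succAbove v k]
    simp only [sub_mul, sum_sub_distrib, mul_add, mul_sum]
    ring
  simp only [key]
  refine sub_lt_sub_left (sum_lt_sum (fun j _ => ?_) ⟨⟨k, by omega⟩, mem_univ _, ?_⟩) _
  · refine mul_le_mul_of_nonneg_left (hv.monotone ?_) (sub_pos.2 (hb j)).le
    simp only [Fin.succAbove, Fin.lt_def, Fin.le_def] at hkl ⊢
    split_ifs <;> simp_all
    omega
  · refine mul_lt_mul_of_pos_left (hv ?_) (sub_pos.2 (hb _))
    simp only [Fin.succAbove, Fin.lt_def] at hkl ⊢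
    split_ifs <;> simp_all

theorem card_orthogonalPerms_le_of_unique_max {n : ℕ} {a v : Fin (n + 1) → ℝ}
    (hv : StrictMono v) (m : Fin (n + 1)) (hm : ∀ j, j ≠ m → a j < a m) :
    (orthogonalPerms a v).card ≤ n.factorial := by
  have h := card_le_of_injective_cover (fun σ : Perm (Fin (n + 1)) => ∑ i, a (σ i) * v i) 0
    (fun (e : Perm (Fin n)) k => Perm.decomposeFin.symm (m, e) * Fin.cycleRange k) ?_
    (orthogonalPerms a v) fun σ hσ => ⟨mem_orthogonalPerms.1 hσ, ?_⟩
  · simpa [Fintype.card_perm] using h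
  · intro e
    have hlt : ∀ j : Fin n, a (Perm.decomposeFin.symm (m, e) j.succ) < a m := by
      refine fun j => hm _ fun hj => Fin.succ_ne_zero j ?_
      exact (Perm.decomposeFin.symm (m, e)).injective
        (hj.trans (Perm.decomposeFin_symm_apply_zero m e).symm)
    convert (strictMono_insert hv hlt).injective using 2 with k
    simp only [Function.comp_apply]
    rw [Fin.sum_univ_succAbove _ k]
    simp [Fin.cycleRange_self, Fin.cycleRange_succAbove]
  · let τ := σ * (Fin.cycleRange (σ⁻¹ m))⁻¹
    have hτ : τ 0 = m := by simp [τ]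
    refine ⟨(Perm.decomposeFin τ).2, σ⁻¹ m, ?_⟩
    have h1 : (Perm.decomposeFin τ).1 = m := by
      have := Perm.decomposeFin_symm_apply_zero (Perm.decomposeFin τ).1 (Perm.decomposeFin τ).2
      rwa [Prod.mk.eta, Equiv.symm_apply_apply, hτ, eq_comm] at this
    have h2 : Perm.decomposeFin.symm (m, (Perm.decomposeFin τ).2) = τ := by
      rw [Equiv.symm_apply_eq, ← h1]
    rw [h2]
    simp [τ]

theorem card_orthogonalPerms_le_of_unique_min {n : ℕ} {a v : Fin (n + 1) → ℝ}
    (hv : StrictMono v) (m : Fin (n + 1)) (hm : ∀ j, j ≠ m → a m < a j) :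
    (orthogonalPerms a v).card ≤ n.factorial := by
  rw [← orthogonalPerms_neg]
  exact card_orthogonalPerms_le_of_unique_max hv m fun j hj => neg_lt_neg (hm j hj)

theorem orthogonalPerms_eq_empty {n : ℕ} {a v : Fin n → ℝ} {c : ℝ} (hc : c ≠ 0)
    (ha : ∀ i, a i = c) (hv : ∑ i, v i ≠ 0) : orthogonalPerms a v = ∅ := by
  refine filter_eq_empty_iff.2 fun σ _ h => ?_
  simp only [ha, ← mul_sum] at h
  exact mul_ne_zero hc hv h

/-- A partition of the thirty words with letters `0, 0, 1, 2, 2` into six chains of five words: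
along each chain the places of the `2`s move up, and those of the `0`s never do. -/
def wordChain : Fin 6 → Fin 5 → Fin 5 → Fin 3 :=
  ![![![2,2,0,1,0], ![2,1,0,2,0], ![2,1,0,0,2], ![1,2,0,0,2], ![1,0,0,2,2]],
    ![![2,2,1,0,0], ![1,2,2,0,0], ![1,2,0,2,0], ![1,0,2,2,0], ![1,0,2,0,2]],
    ![![2,0,0,2,1], ![2,0,0,1,2], ![0,2,0,1,2], ![0,0,2,1,2], ![0,0,1,2,2]],
    ![![2,2,0,0,1], ![2,0,2,0,1], ![0,2,2,0,1], ![0,2,0,2,1], ![0,0,2,2,1]],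
    ![![2,0,2,1,0], ![2,0,1,2,0], ![2,0,1,0,2], ![0,2,1,0,2], ![0,1,0,2,2]],
    ![![2,1,2,0,0], ![0,2,2,1,0], ![0,2,1,2,0], ![0,1,2,2,0], ![0,1,2,0,2]]]

theorem exists_wordChain_eq (σ : Perm (Fin 5)) :
    ∃ r k, wordChain r k = (![0, 0, 1, 2, 2] : Fin 5 → Fin 3) ∘ σ := by
  revert σ
  decide +kernel

theorem strictMono_wordChain {x : Fin 3 → ℝ} (h01 : x 0 ≤ x 1) (h12 : x 1 < x 2)
    {v : Fin 5 → ℝ} (hv : StrictMono v) (r : Fin 6) :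
    StrictMono fun k => ∑ i, x (wordChain r k i) * v i := by
  have hgap : ∀ i : Fin 4, 0 < v i.succ - v i.castSucc := fun i => sub_pos.2 (hv i.castSucc_lt_succ)
  have hl : ∀ i, 0 ≤ (x 1 - x 0) * (v (Fin.succ i) - v i.castSucc) :=
    fun i => mul_nonneg (sub_nonneg.2 h01) (hgap i).le
  have hu : ∀ i, 0 < (x 2 - x 1) * (v (Fin.succ i) - v i.castSucc) :=
    fun i => mul_pos (sub_pos.2 h12) (hgap i)
  simp only [Fin.forall_fin_succ] at hl hu
  simp at hl hu
  rw [Fin.strictMono_iff_lt_succ]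
  intro k
  simp only [Fin.sum_univ_five]
  fin_cases r <;> fin_cases k <;> simp [wordChain] <;> linarith

theorem card_orthogonalPerms_le_of_double_ends {a v : Fin 5 → ℝ} (hv : StrictMono v)
    (h01 : a 0 = a 1) (h12 : a 1 ≤ a 2) (h23 : a 2 < a 3) (h34 : a 3 = a 4) :
    (orthogonalPerms a v).card ≤ 24 := by
  let q : Fin 5 → Fin 3 := ![0, 0, 1, 2, 2]
  let x : Fin 3 → ℝ := ![a 1, a 2, a 3]
  have hq : ∀ i, a i = x (q i) := by
    intro i
    fin_cases i <;> simp [x, q, h01, h34]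
  have hstab : (univ.filter fun τ : Perm (Fin 5) => q ∘ τ = q).card = 4 := by
    decide +kernel
  have hwords := card_le_of_injective_cover (fun w : Fin 5 → Fin 3 => ∑ i, x (w i) * v i) 0
    wordChain (fun r => (strictMono_wordChain (x := x) h12 h23 hv r).injective)
    ((orthogonalPerms a v).image fun σ : Perm (Fin 5) => q ∘ σ) (by
      simp only [mem_image]
      rintro _ ⟨σ, hσ, rfl⟩
      refine ⟨?_, exists_wordChain_eq σ⟩
      simpa [mem_orthogonalPerms, hq] using hσ)
  have h := card_perm_le_mul_card_colorings q (orthogonalPerms a v)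
  rw [hstab] at h
  rw [Fintype.card_fin] at hwords
  omega

theorem card_orthogonalPerms_three_le {a v : Fin 3 → ℝ} (ha0 : a ≠ 0) (ha : Monotone a)
    (hv : StrictMono v) (hsum : ∑ i, v i ≠ 0) : (orthogonalPerms a v).card ≤ 2 := by
  have h01 : a 0 ≤ a 1 := ha (by decide)
  have h12 : a 1 ≤ a 2 := ha (by decide)
  rcases h12.lt_or_eq with h | h
  · refine card_orthogonalPerms_le_of_unique_max (n := 2) hv 2 fun j hj => ?_
    fin_cases j <;> simp at hj ⊢ <;> linarith
  rcases h01.lt_or_eq with h' | h'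
  · refine card_orthogonalPerms_le_of_unique_min (n := 2) hv 0 fun j hj => ?_
    fin_cases j <;> simp at hj ⊢ <;> linarith
  have hconst : ∀ i, a i = a 0 := by
    intro i
    fin_cases i <;> simp <;> linarith
  have hne : a 0 ≠ 0 := fun h0 => ha0 (funext fun i => (hconst i).trans h0)
  simp [orthogonalPerms_eq_empty hne hconst hsum]

theorem card_orthogonalPerms_five_le {a v : Fin 5 → ℝ} (ha0 : a ≠ 0) (ha : Monotone a)
    (hv : StrictMono v) (hsum : ∑ i, v i ≠ 0) : (orthogonalPerms a v).card ≤ 24 := by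
  have h01 : a 0 ≤ a 1 := ha (by decide)
  have h12 : a 1 ≤ a 2 := ha (by decide)
  have h23 : a 2 ≤ a 3 := ha (by decide)
  have h34 : a 3 ≤ a 4 := ha (by decide)
  rcases h34.lt_or_eq with e34 | e34
  · refine card_orthogonalPerms_le_of_unique_max (n := 4) hv 4 fun j hj => ?_
    fin_cases j <;> simp at hj ⊢ <;> linarith
  rcases h01.lt_or_eq with e01 | e01
  · refine card_orthogonalPerms_le_of_unique_min (n := 4) hv 0 fun j hj => ?_
    fin_cases j <;> simp at hj ⊢ <;> linarith
  rcases h23.lt_or_eq with e23 | e23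
  · exact card_orthogonalPerms_le_of_double_ends hv e01 h12 e23 e34
  rcases h12.lt_or_eq with e12 | e12
  · rw [← orthogonalPerms_neg]
    refine (card_orthogonalPerms_le_comp (-a) v Fin.revPerm 1).trans
      (card_orthogonalPerms_le_of_double_ends hv ?_ ?_ ?_ ?_) <;>
    simp [Fin.rev] <;> linarith
  have hconst : ∀ i, a i = a 0 := by
    intro i
    fin_cases i <;> simp <;> linarith
  have hne : a 0 ≠ 0 := fun h0 => ha0 (funext fun i => (hconst i).trans h0)
  simp [orthogonalPerms_eq_empty hne hconst hsum]

/-- Let `p ∈ {3, 5}` and let `a ∈ ℝ^p` be nonzero. Then for every `v ∈ ℝ^p`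
with pairwise distinct coordinates not summing to `0`, the hyperplane
`H = {x | ∑ m, a m * x m = 0}` satisfies `|H ∩ Sₚ·v| ≤ (p-1)!`. -/
theorem stmt11 (p : ℕ) (hp : p = 3 ∨ p = 5)
    (a : Fin p → ℝ) (ha : a ≠ 0)
    (v : Fin p → ℝ) (hv : ∀ i j : Fin p, i ≠ j → v i ≠ v j)
    (hsum : ∑ i, v i ≠ 0) :
    ({x : Fin p → ℝ | ∑ m, a m * x m = 0} ∩
      {w : Fin p → ℝ | ∃ σ : Equiv.Perm (Fin p), w = fun m => v (σ⁻¹ m)}).ncard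
      ≤ (p - 1).factorial := by
  let ρ := Tuple.sort a
  let π := Tuple.sort v
  have ha0 : a ∘ ρ ≠ 0 := fun h => ha (funext fun i => by simpa using congrFun h (ρ.symm i))
  have hmono : StrictMono (v ∘ π) := (Tuple.monotone_sort v).strictMono_of_injective
    (Function.Injective.comp (fun i j h => by_contra fun hij => hv i j hij h) π.injective)
  have hsum' : ∑ i, (v ∘ π) i ≠ 0 := by
    simpa only [Function.comp_apply, Equiv.sum_comp π v] using hsum
  refine (ncard_orbit_inter_le a v).trans ((card_orthogonalPerms_le_comp a v ρ π).trans ?_)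
  rcases hp with rfl | rfl
  · exact card_orthogonalPerms_three_le ha0 (Tuple.monotone_sort a) hmono hsum'
  · exact card_orthogonalPerms_five_le ha0 (Tuple.monotone_sort a) hmono hsum'
end

section
/- Let p ≥ 5 be a prime, let v ∈ ℝ^p have pairwise distinct coordinates, and let a = (a_1,…,a_p) ∈ ℝ^p. Let i, j, k, l be distinct indices, let σ = (i j)(k l) ∈ S_p be the product of the two disjoint transpositions, let π ∈ S_p be a p-cycle, and let G ≤ S_p be a subgroup containing π such that the real linear span of the orbit G·v has dimension greater than 3. If every element of G·v and every element of σ·(G·v) lies in {x ∈ ℝ^p : Σ_m a_m x_m = 0}, then a_i = a_j and a_k = a_l. -/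
open scoped ZMod

/-- Over `ℚ`, the only linear relations between the `p`-th roots of unity are the multiples of
the relation that their sum vanishes. -/
theorem eq_zero_of_sum_mul_stdAddChar_eq_zero {p : ℕ} [Fact p.Prime] (f : ZMod p → ℤ)
    (hf : ∑ x, f x = 0) (h : ∑ x, (f x : ℂ) * ZMod.stdAddChar x = 0) : f = 0 := by
  have hp : p.Prime := Fact.out
  set ζ : ℂ := ZMod.stdAddChar (1 : ZMod p) with hζdef
  have hpow (n : ℕ) : ζ ^ n = ZMod.stdAddChar (n : ZMod p) := by
    rw [hζdef, ← AddChar.map_nsmul_eq_pow, nsmul_one]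
  have hζ : IsPrimitiveRoot ζ p := by
    refine IsPrimitiveRoot.mk_of_lt ζ hp.pos (by simp [hpow]) fun n hn hnp hone => ?_
    rw [hpow, ← AddChar.map_zero_eq_one (ZMod.stdAddChar (N := p))] at hone
    have h0 := ZMod.injective_stdAddChar hone
    rw [ZMod.natCast_eq_zero_iff] at h0
    exact absurd (Nat.le_of_dvd hn h0) (by omega)
  let P : Polynomial ℚ := ∑ x : ZMod p, Polynomial.monomial x.val (f x : ℚ)
  have hcyc : Polynomial.cyclotomic p ℚ ∣ P := by
    rw [Polynomial.cyclotomic_eq_minpoly_rat hζ hp.pos]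
    refine minpoly.dvd ℚ ζ ?_
    simpa [P, Polynomial.aeval_monomial, hpow] using h
  have hone : Polynomial.cyclotomic 1 ℚ ∣ P := by
    rw [Polynomial.cyclotomic_one, ← Polynomial.C_1, Polynomial.dvd_iff_isRoot,
      Polynomial.IsRoot.def]
    simp only [P, Polynomial.eval_finsetSum, Polynomial.eval_monomial, one_pow, mul_one]
    exact_mod_cast hf
  have hdvd : (Polynomial.X ^ p - 1 : Polynomial ℚ) ∣ P := by
    rw [← Polynomial.cyclotomic_prime_mul_X_sub_one, ← Polynomial.cyclotomic_one]
    exact (Polynomial.cyclotomic.isCoprime_rat hp.ne_one).mul_dvd hcyc hone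
  have hP : P = 0 := by
    refine Polynomial.eq_zero_of_dvd_of_degree_lt hdvd ?_
    rw [← Polynomial.C_1, Polynomial.degree_X_pow_sub_C hp.pos]
    refine (Polynomial.degree_sum_le _ _).trans_lt ?_
    rw [Finset.sup_lt_iff (WithBot.bot_lt_coe _)]
    intro x _
    refine (Polynomial.degree_monomial_le _ _).trans_lt ?_
    exact_mod_cast ZMod.val_lt x
  funext x
  have hx := congrArg (fun Q => Polynomial.coeff Q x.val) hP
  simpa [P, Polynomial.finsetSum_coeff, Polynomial.coeff_monomial,
    (ZMod.val_injective p).eq_iff] using hx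

theorem sub_eq_mul_sub_of_stdAddChar_mul_eq {p : ℕ} [Fact p.Prime] {i j k l r : ZMod p}
    (hij : i ≠ j) (hik : i ≠ k) (hkl : k ≠ l) (hr0 : r ≠ 0) (hr1 : r ≠ 1)
    (h : ((ZMod.stdAddChar i : ℂ) - ZMod.stdAddChar j) *
        (ZMod.stdAddChar (r * k) - ZMod.stdAddChar (r * l)) =
      (ZMod.stdAddChar (r * i) - ZMod.stdAddChar (r * j)) *
        (ZMod.stdAddChar k - ZMod.stdAddChar l)) :
    i - l = r * (j - k) := by
  let δ (y x : ZMod p) : ℤ := if x = y then 1 else 0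
  have hnn (y x : ZMod p) : 0 ≤ δ y x := by simp only [δ]; split_ifs <;> simp
  have hs (y : ZMod p) : ∑ x, δ y x = 1 := by simp [δ]
  have hz (y : ZMod p) : ∑ x, (δ y x : ℂ) * ZMod.stdAddChar x = ZMod.stdAddChar y := by
    simp [δ]
  have hne {y x : ZMod p} (hxy : x ≠ y) : δ y x = 0 := if_neg hxy
  have key := eq_zero_of_sum_mul_stdAddChar_eq_zero
    (fun x => δ (i + r * k) x + δ (j + r * l) x + δ (r * i + l) x + δ (r * j + k) x
      - δ (i + r * l) x - δ (j + r * k) x - δ (r * i + k) x - δ (r * j + l) x)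
    (by simp only [Finset.sum_add_distrib, Finset.sum_sub_distrib, hs]; norm_num)
    (by
      push_cast
      simp only [add_mul, sub_mul, Finset.sum_add_distrib, Finset.sum_sub_distrib, hz,
        AddChar.map_add_eq_mul]
      linear_combination h)
  have hx := congrFun key (i + r * k)
  have h1 : δ (i + r * k) (i + r * k) = 1 := if_pos rfl
  have h2 : δ (i + r * l) (i + r * k) = 0 :=
    hne fun e => hkl (mul_left_cancel₀ hr0 (add_left_cancel e))
  have h3 : δ (j + r * k) (i + r * k) = 0 := hne fun e => hij (add_right_cancel e)
  have h4 : δ (r * i + k) (i + r * k) = 0 := hne fun e => by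
    have : (1 - r) * (i - k) = 0 := by linear_combination e
    rcases mul_eq_zero.1 this with h | h
    · exact hr1 (sub_eq_zero.1 h).symm
    · exact hik (sub_eq_zero.1 h)
  have h5 : δ (r * j + l) (i + r * k) ≠ 0 := fun h5 => by
    have := hnn (j + r * l) (i + r * k)
    have := hnn (r * i + l) (i + r * k)
    have := hnn (r * j + k) (i + r * k)
    simp only [h1, h2, h3, h4, h5, Pi.zero_apply] at hx
    omega
  have h6 : i + r * k = r * j + l := by_contra fun e => h5 (hne e)
  linear_combination h6

/-- The transform at `t` of the real vector with values `α`, `-α`, `β`, `-β` at `i`, `j`, `k`, `l`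
and zero elsewhere. -/
noncomputable def fourierFourPoint {p : ℕ} [NeZero p] (α β : ℝ) (i j k l t : ZMod p) : ℂ :=
  α * (ZMod.stdAddChar (t * i) - ZMod.stdAddChar (t * j)) +
    β * (ZMod.stdAddChar (t * k) - ZMod.stdAddChar (t * l))

theorem conj_stdAddChar {p : ℕ} [NeZero p] (x : ZMod p) :
    (starRingEnd ℂ) (ZMod.stdAddChar x) = ZMod.stdAddChar (-x) := by
  rw [AddChar.map_neg_eq_conj]

theorem fourierFourPoint_neg {p : ℕ} [NeZero p] (α β : ℝ) (i j k l t : ZMod p) :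
    fourierFourPoint α β i j k l (-t) = (starRingEnd ℂ) (fourierFourPoint α β i j k l t) := by
  simp [fourierFourPoint, conj_stdAddChar]

/-- A nonzero real vector `α (e_i - e_j) + β (e_k - e_l)` has at most one pair of opposite nonzero
frequencies at which its transform vanishes. -/
theorem eq_or_eq_neg_of_fourierFourPoint_eq_zero {p : ℕ} [Fact p.Prime] (hp2 : p ≠ 2) {α β : ℝ}
    (hαβ : ¬(α = 0 ∧ β = 0)) {i j k l : ZMod p} (hij : i ≠ j) (hik : i ≠ k) (hjk : j ≠ k)
    (hkl : k ≠ l) {s t : ZMod p} (hs : s ≠ 0) (ht : t ≠ 0)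
    (hus : fourierFourPoint α β i j k l s = 0) (hut : fourierFourPoint α β i j k l t = 0) :
    t = s ∨ t = -s := by
  have key {r : ZMod p} (hr0 : r ≠ 0) (hr1 : r ≠ 1)
      (hur : fourierFourPoint α β i j k l (r * s) = 0) :
      s * i - s * l = r * (s * j - s * k) := by
    have hinj {x y : ZMod p} (hxy : x ≠ y) : s * x ≠ s * y :=
      fun e => hxy (mul_left_cancel₀ hs e)
    refine sub_eq_mul_sub_of_stdAddChar_mul_eq (hinj hij) (hinj hik) (hinj hkl) hr0 hr1 ?_
    unfold fourierFourPoint at hus hur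
    simp only [mul_assoc r s] at hur
    by_cases hα : α = 0
    · have hβ : (β : ℂ) ≠ 0 := by exact_mod_cast fun h => hαβ ⟨hα, h⟩
      refine mul_left_cancel₀ hβ ?_
      subst hα
      simp only [Complex.ofReal_zero, zero_mul, zero_add] at hus hur
      linear_combination (ZMod.stdAddChar (s * i) - ZMod.stdAddChar (s * j)) * hur
        - (ZMod.stdAddChar (r * (s * i)) - ZMod.stdAddChar (r * (s * j))) * hus
    · have hα' : (α : ℂ) ≠ 0 := by exact_mod_cast hα
      refine mul_left_cancel₀ hα' ?_
      linear_combination (ZMod.stdAddChar (r * (s * k)) - ZMod.stdAddChar (r * (s * l))) * hus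
        - (ZMod.stdAddChar (s * k) - ZMod.stdAddChar (s * l)) * hur
  by_contra! hts
  have hneg := key (r := -1) (by simp)
    (by
      have : Fact (2 < p) := ⟨lt_of_le_of_ne (Fact.out : p.Prime).two_le hp2.symm⟩
      exact ZMod.neg_one_ne_one)
    (by rw [neg_one_mul, fourierFourPoint_neg, hus, map_zero])
  have hq := key (r := t / s) (div_ne_zero ht hs)
    (fun e => hts.1 ((div_eq_one_iff_eq hs).1 e)) (by rwa [div_mul_cancel₀ t hs])
  have h0 : (t + s) * (j - k) = 0 := by
    have : (t / s + 1) * s * (j - k) = 0 := by linear_combination hneg - hq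
    rwa [add_mul, div_mul_cancel₀ t hs, one_mul] at this
  rcases mul_eq_zero.1 h0 with h | h
  · exact hts.2 (eq_neg_of_add_eq_zero_left h)
  · exact hjk (sub_eq_zero.1 h)

theorem dft_comp_add_left {p : ℕ} [NeZero p] (w : ZMod p → ℂ) (y t : ZMod p) :
    𝓕 (fun x => w (y + x)) t = ZMod.stdAddChar (t * y) * 𝓕 w t := by
  simp only [ZMod.dft_apply, smul_eq_mul, Finset.mul_sum]
  refine Fintype.sum_equiv (Equiv.addLeft y) _ _ fun x => ?_
  rw [← mul_assoc, ← AddChar.map_add_eq_mul, Equiv.coe_addLeft]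
  congr 2
  ring

theorem dft_ofReal_neg {p : ℕ} [NeZero p] (w : ZMod p → ℝ) (t : ZMod p) :
    𝓕 (fun x => (w x : ℂ)) (-t) = (starRingEnd ℂ) (𝓕 (fun x => (w x : ℂ)) t) := by
  simp [ZMod.dft_apply, conj_stdAddChar]

theorem finrank_le_three_of_dft_support {p : ℕ} [NeZero p] (W : Submodule ℝ (ZMod p → ℝ))
    (s : ZMod p)
    (hW : ∀ w ∈ W, ∀ t, t ≠ 0 → t ≠ s → t ≠ -s → 𝓕 (fun x => (w x : ℂ)) t = 0) :
    Module.finrank ℝ W ≤ 3 := by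
  let F : (ZMod p → ℝ) →ₗ[ℝ] ℝ × ℂ :=
    { toFun := fun w => (∑ x, w x, 𝓕 (fun x => (w x : ℂ)) s)
      map_add' := fun w w' => by
        simp [ZMod.dft_apply, Finset.sum_add_distrib, mul_add]
      map_smul' := fun c w => by
        simp [ZMod.dft_apply, Finset.mul_sum, mul_left_comm] }
  have hF : Function.Injective (F.domRestrict W) := by
    rw [← LinearMap.ker_eq_bot, LinearMap.ker_eq_bot']
    rintro ⟨w, hw⟩ h
    have h1 : ∑ x, w x = 0 := congrArg Prod.fst h
    have h2 : 𝓕 (fun x => (w x : ℂ)) s = 0 := congrArg Prod.snd h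
    have h3 : 𝓕 (fun x => (w x : ℂ)) = 0 := by
      funext t
      by_cases ht0 : t = 0
      · rw [ht0, ZMod.dft_apply_zero, Pi.zero_apply]
        exact_mod_cast h1
      by_cases hts : t = s
      · rw [hts, h2, Pi.zero_apply]
      by_cases htn : t = -s
      · rw [htn, dft_ofReal_neg, h2, map_zero, Pi.zero_apply]
      exact hW w hw t ht0 hts htn
    have h4 := (LinearEquiv.map_eq_zero_iff _).1 h3
    ext x
    exact Complex.ofReal_eq_zero.1 (congrFun h4 x)
  refine (LinearMap.finrank_le_finrank_of_injective hF).trans_eq ?_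
  rw [Module.finrank_prod, Module.finrank_self, Complex.finrank_real_complex]

/-- If all translates of `α (e_i - e_j) + β (e_k - e_l)` annihilate a space of real functions on
`ZMod p` of dimension greater than three, then `α = β = 0`. -/
theorem eq_zero_of_translates_annihilate {p : ℕ} [Fact p.Prime] (hp2 : p ≠ 2) {α β : ℝ}
    {i j k l : ZMod p} (hij : i ≠ j) (hik : i ≠ k) (hjk : j ≠ k) (hkl : k ≠ l)
    (W : Submodule ℝ (ZMod p → ℝ)) (hdim : 3 < Module.finrank ℝ W)
    (hW : ∀ w ∈ W, ∀ x, α * (w (i + x) - w (j + x)) + β * (w (k + x) - w (l + x)) = 0) :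
    α = 0 ∧ β = 0 := by
  by_contra hαβ
  have hmul (w) (hw : w ∈ W) (t : ZMod p) :
      fourierFourPoint α β i j k l t * 𝓕 (fun x => (w x : ℂ)) t = 0 := by
    have hzero : ∑ x, (ZMod.stdAddChar (-(x * t)) : ℂ) *
        (α * (w (i + x) - w (j + x)) + β * (w (k + x) - w (l + x))) = 0 :=
      Finset.sum_eq_zero fun x _ => by
        rw [mul_eq_zero]
        exact Or.inr (by exact_mod_cast hW w hw x)
    have hshift (y : ZMod p) := dft_comp_add_left (fun x => (w x : ℂ)) y t
    simp only [ZMod.dft_apply (fun x => (w (_ + x) : ℂ)), smul_eq_mul] at hshift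
    rw [fourierFourPoint, ← hzero]
    simp only [add_mul, sub_mul, mul_assoc, ← hshift, Finset.mul_sum, mul_sub, mul_add,
      Finset.sum_add_distrib, Finset.sum_sub_distrib, mul_left_comm]
  refine hdim.not_ge ?_
  by_cases hs : ∃ s : ZMod p, s ≠ 0 ∧ fourierFourPoint α β i j k l s = 0
  · obtain ⟨s, hs0, hs⟩ := hs
    refine finrank_le_three_of_dft_support W s fun w hw t ht0 hts htn => ?_
    refine (mul_eq_zero.1 (hmul w hw t)).resolve_left fun hut => ?_
    rcases eq_or_eq_neg_of_fourierFourPoint_eq_zero hp2 hαβ hij hik hjk hkl hs0 ht0 hs hut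
      with h | h
    exacts [hts h, htn h]
  · push Not at hs
    exact finrank_le_three_of_dft_support W 0 fun w hw t ht0 _ _ =>
      (mul_eq_zero.1 (hmul w hw t)).resolve_left (hs t ht0)

/-- A cycle on all of `Fin p` is conjugate to the translation by one on `ZMod p`. -/
theorem exists_equiv_zmod_of_isCycle {p : ℕ} [NeZero p] {π : Equiv.Perm (Fin p)}
    (hπ : π.IsCycle) (hsupp : π.support = Finset.univ) :
    ∃ e : ZMod p ≃ Fin p, ∀ (n : ℕ) (x : ZMod p), (π ^ n) (e x) = e (x + n) := by
  have hord : orderOf π = p := by rw [hπ.orderOf, hsupp, Finset.card_univ, Fintype.card_fin]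
  have hmem (y : Fin p) : π y ≠ y := by
    rw [← Equiv.Perm.mem_support, hsupp]
    exact Finset.mem_univ y
  let f (x : ZMod p) : Fin p := (π ^ x.val) 0
  have hf (n : ℕ) : f n = (π ^ n) 0 := by
    have hmod := pow_mod_orderOf π n
    rw [hord] at hmod
    simp only [f, ZMod.val_natCast, hmod]
  have hsurj : Function.Surjective f := fun y => by
    obtain ⟨n, hn⟩ := hπ.exists_pow_eq (hmem 0) (hmem y)
    exact ⟨n, (hf n).trans hn⟩
  have hbij : Function.Bijective f :=
    (Fintype.bijective_iff_surjective_and_card f).2 ⟨hsurj, by simp [ZMod.card]⟩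
  refine ⟨Equiv.ofBijective f hbij, fun n x => ?_⟩
  obtain ⟨m, rfl⟩ := ZMod.natCast_zmod_surjective x
  rw [Equiv.ofBijective_apply, Equiv.ofBijective_apply, ← Nat.cast_add, hf, hf, add_comm m n,
    pow_add, Equiv.Perm.mul_apply]

/-- Let `p ≥ 5` be prime, `v ∈ ℝ^p` with pairwise distinct coordinates, and
`a ∈ ℝ^p`. Let `i, j, k, l` be distinct, `σ = (i j)(k l)`, `π` a `p`-cycle, and `G ≤ Sₚ` a
subgroup containing `π` with `dim span(G·v) > 3`. If every element of `G·v` and of `σ·(G·v)`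
lies on the hyperplane `∑ m, a m * x m = 0`, then `a i = a j` and `a k = a l`. -/
theorem stmt12 (p : ℕ) (hp : p.Prime) (hp5 : 5 ≤ p)
    (v a : Fin p → ℝ) (hv : ∀ i j : Fin p, i ≠ j → v i ≠ v j)
    (i j k l : Fin p) (hij : i ≠ j) (hik : i ≠ k) (hil : i ≠ l)
    (hjk : j ≠ k) (hjl : j ≠ l) (hkl : k ≠ l)
    (π : Equiv.Perm (Fin p)) (hπ : π.IsCycle) (hπsupp : π.support = Finset.univ)
    (G : Subgroup (Equiv.Perm (Fin p))) (hπG : π ∈ G)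
    (hdim : 3 < Module.finrank ℝ
      (Submodule.span ℝ {w : Fin p → ℝ | ∃ g ∈ G, w = fun m => v (g⁻¹ m)}))
    (h1 : ∀ g ∈ G, ∑ m, a m * v (g⁻¹ m) = 0)
    (h2 : ∀ g ∈ G, ∑ m, a m * v (g⁻¹ ((Equiv.swap i j * Equiv.swap k l)⁻¹ m)) = 0) :
    a i = a j ∧ a k = a l := by
  have : Fact p.Prime := ⟨hp⟩
  obtain ⟨e, he⟩ := exists_equiv_zmod_of_isCycle hπ hπsupp
  set W := Submodule.span ℝ {w : Fin p → ℝ | ∃ g ∈ G, w = fun m => v (g⁻¹ m)}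
  have hinv (w) (hw : w ∈ W) (g) (hg : g ∈ G) : (fun m => w (g m)) ∈ W := by
    refine Submodule.span_induction (p := fun w _ => (fun m => w (g m)) ∈ W) ?_ W.zero_mem
      (fun _ _ _ _ h h' => W.add_mem h h') (fun c _ _ h => W.smul_mem c h) hw
    rintro _ ⟨g', hg', rfl⟩
    exact Submodule.subset_span ⟨g⁻¹ * g', G.mul_mem (G.inv_mem hg) hg', by simp⟩
  have hann (w) (hw : w ∈ W) :
      ∑ m, a m * (w m - w ((Equiv.swap i j * Equiv.swap k l)⁻¹ m)) = 0 := by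
    refine Submodule.span_induction
      (p := fun w _ => ∑ m, a m * (w m - w ((Equiv.swap i j * Equiv.swap k l)⁻¹ m)) = 0)
      ?_ (by simp) (fun w w' _ _ h h' => ?_) (fun c w _ h => ?_) hw
    · rintro _ ⟨g, hg, rfl⟩
      simp only [mul_sub, Finset.sum_sub_distrib]
      rw [h1 g hg, h2 g hg, sub_zero]
    · rw [← add_zero (0 : ℝ)]
      nth_rewrite 1 [← h]
      rw [← h', ← Finset.sum_add_distrib]
      exact Finset.sum_congr rfl fun m _ => by simp only [Pi.add_apply]; ring
    · rw [← mul_zero c, ← h, Finset.mul_sum]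
      exact Finset.sum_congr rfl fun m _ => by simp only [Pi.smul_apply, smul_eq_mul]; ring
  have hrel (w) (hw : w ∈ W) : (a i - a j) * (w i - w j) + (a k - a l) * (w k - w l) = 0 := by
    rw [← hann w hw, ← Finset.sum_subset (Finset.subset_univ {i, j, k, l})]
    · rw [Finset.sum_insert (by simp [hij, hik, hil]), Finset.sum_insert (by simp [hjk, hjl]),
        Finset.sum_insert (by simp [hkl]), Finset.sum_singleton]
      simp only [mul_inv_rev, Equiv.swap_inv, Equiv.Perm.mul_apply, Equiv.swap_apply_left,
        Equiv.swap_apply_right, Equiv.swap_apply_of_ne_of_ne hik.symm hjk.symm,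
        Equiv.swap_apply_of_ne_of_ne hil.symm hjl.symm,
        Equiv.swap_apply_of_ne_of_ne hik hil, Equiv.swap_apply_of_ne_of_ne hjk hjl]
      ring
    · intro m _ hm
      simp only [Finset.mem_insert, Finset.mem_singleton, not_or] at hm
      obtain ⟨hmi, hmj, hmk, hml⟩ := hm
      simp only [mul_inv_rev, Equiv.swap_inv, Equiv.Perm.mul_apply,
        Equiv.swap_apply_of_ne_of_ne hmi hmj, Equiv.swap_apply_of_ne_of_ne hmk hml, sub_self,
        mul_zero]
  let L := LinearEquiv.funCongrLeft ℝ ℝ e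
  have hne {x y : Fin p} (hxy : x ≠ y) : e.symm x ≠ e.symm y := e.symm.injective.ne hxy
  have h := eq_zero_of_translates_annihilate (α := a i - a j) (β := a k - a l)
    (show p ≠ 2 by omega) (hne hij) (hne hik) (hne hjk) (hne hkl)
    (W.map (L : (Fin p → ℝ) →ₗ[ℝ] (ZMod p → ℝ)))
    (by rwa [LinearEquiv.finrank_map_eq])
    (by
      rintro _ ⟨w, hw, rfl⟩ x
      obtain ⟨n, rfl⟩ := ZMod.natCast_zmod_surjective x
      have hr := hrel _ (hinv w hw (π ^ n) (G.pow_mem hπG n))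
      simpa [L, LinearEquiv.funCongrLeft_apply, LinearMap.funLeft_apply, ← he] using hr)
  exact ⟨sub_eq_zero.1 h.1, sub_eq_zero.1 h.2⟩
end

section
/- Let p ≥ 7 be a prime, let ζ = e^{2πi/p} ∈ ℂ, and let w = (ζ, ζ², …, ζ^p) ∈ ℂ^p (so w_t = ζ^t). Let σ ∈ S_p, let a = (a_1,…,a_p) ∈ ℝ^p, and let i, j, k, l be distinct indices in {1,…,p}. If Σ_m a_m (σ·w)_m = 0 and Σ_m a_m (((i j)(k l))·σ·w)_m = 0, then either σ⁻¹(i) + σ⁻¹(j) ≡ σ⁻¹(k) + σ⁻¹(l) (mod p), or both a_i = a_j and a_k = a_l. -/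
/-- A vanishing real combination of two nonzero chords of the unit circle is trivial unless the
chords are parallel, i.e. unless the products of their endpoints agree. -/
lemma mul_eq_mul_or_eq_zero_of_chord_combination {A B C D : ℂ} (hA : ‖A‖ = 1) (hB : ‖B‖ = 1)
    (hC : ‖C‖ = 1) (hD : ‖D‖ = 1) (hAB : A ≠ B) (hCD : C ≠ D) {α β : ℝ}
    (h : (α : ℂ) * (A - B) + β * (C - D) = 0) : A * B = C * D ∨ (α = 0 ∧ β = 0) := by
  have unit : ∀ {z : ℂ}, ‖z‖ = 1 → z * starRingEnd ℂ z = 1 := fun hz => by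
    rw [Complex.mul_conj']; simp [hz]
  have hc := congrArg (starRingEnd ℂ) h
  simp only [map_add, map_mul, map_sub, Complex.conj_ofReal, map_zero] at hc
  have key : (β : ℂ) * (C - D) * (C * D - A * B) = 0 := by
    linear_combination (A * B * C * D) * hc + (C * D) * h
      - (α * B * C * D) * unit hA + (α * A * C * D) * unit hB
      - (β * A * B * D) * unit hC + (β * A * B * C) * unit hD
  by_cases hβ : β = 0
  · right
    subst hβ
    simpa [sub_eq_zero, hAB] using h
  · left
    simpa [hβ, sub_eq_zero, hCD, eq_comm] using key

/-- Precomposing with the inverse of a product of two disjoint transpositions changes a weighted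
sum only through the four moved indices. -/
lemma sum_sub_sum_swap_mul_swap {ι R : Type*} [Fintype ι] [DecidableEq ι] [CommRing R]
    (a f : ι → R) {i j k l : ι} (hij : i ≠ j) (hik : i ≠ k) (hil : i ≠ l)
    (hjk : j ≠ k) (hjl : j ≠ l) (hkl : k ≠ l) :
    ∑ m, a m * f m - ∑ m, a m * f ((Equiv.swap i j * Equiv.swap k l)⁻¹ m)
      = (a i - a j) * (f i - f j) + (a k - a l) * (f k - f l) := by
  rw [← Finset.sum_sub_distrib, ← Finset.sum_subset (Finset.subset_univ {i, j, k, l})]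
  · rw [Finset.sum_insert (by simp [*]), Finset.sum_insert (by simp [*]),
      Finset.sum_insert (by simp [*]), Finset.sum_singleton]
    simp [Equiv.swap_apply_of_ne_of_ne, hik, hil, hjk, hjl, hik.symm, hil.symm,
      hjk.symm, hjl.symm]
    ring
  · intro m _ hm
    simp only [Finset.mem_insert, Finset.mem_singleton, not_or] at hm
    obtain ⟨hi, hj, hk, hl⟩ := hm
    simp [Equiv.swap_apply_of_ne_of_ne, hi, hj, hk, hl]


/-- Let `p ≥ 7` be prime, `ζ = e^{2πi/p}`, and `w = (ζ, ζ², …, ζ^p) ∈ ℂ^p`.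
Let `σ ∈ Sₚ`, `a ∈ ℝ^p`, and `i, j, k, l` distinct indices. If the hyperplane `a^⊥` contains
both `σ·w` and `((i j)(k l))·σ·w`, then either `σ⁻¹(i) + σ⁻¹(j) ≡ σ⁻¹(k) + σ⁻¹(l) (mod p)`,
or both `a i = a j` and `a k = a l`. (Here the index `t ∈ Fin p` corresponds to the paper's
index `t + 1 ∈ {1,…,p}`, so `w t = ζ^(t+1)`; the congruence is unaffected.) -/
theorem stmt13 (p : ℕ) (hp : p.Prime) (hp7 : 7 ≤ p)
    (ζ : ℂ) (hζ : ζ = Complex.exp (2 * Real.pi * Complex.I / p))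
    (w : Fin p → ℂ) (hw : ∀ t : Fin p, w t = ζ ^ ((t : ℕ) + 1))
    (σ : Equiv.Perm (Fin p)) (a : Fin p → ℝ)
    (i j k l : Fin p) (hij : i ≠ j) (hik : i ≠ k) (hil : i ≠ l)
    (hjk : j ≠ k) (hjl : j ≠ l) (hkl : k ≠ l)
    (h1 : ∑ m, (a m : ℂ) * w (σ⁻¹ m) = 0)
    (h2 : ∑ m, (a m : ℂ) * w (σ⁻¹ ((Equiv.swap i j * Equiv.swap k l)⁻¹ m)) = 0) :
    (((σ⁻¹ i : Fin p) : ℕ) + ((σ⁻¹ j : Fin p) : ℕ)) % p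
        = (((σ⁻¹ k : Fin p) : ℕ) + ((σ⁻¹ l : Fin p) : ℕ)) % p ∨
      (a i = a j ∧ a k = a l) := by
  have hprim : IsPrimitiveRoot ζ p := hζ ▸ Complex.isPrimitiveRoot_exp p hp.ne_zero
  have hnorm : ∀ t, ‖w t‖ = 1 := fun t => by
    rw [hw, norm_pow, hprim.norm'_eq_one hp.ne_zero, one_pow]
  have hinj : ∀ {s t : Fin p}, s ≠ t → w (σ⁻¹ s) ≠ w (σ⁻¹ t) := fun {s t} hst h => by
    rw [hw, hw, pow_succ, pow_succ] at h
    exact hst (σ⁻¹.injective (Fin.ext (hprim.pow_inj (σ⁻¹ s).isLt (σ⁻¹ t).isLt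
      (mul_right_cancel₀ (hprim.ne_zero hp.ne_zero) h))))
  have hdiff := sum_sub_sum_swap_mul_swap (fun m => (a m : ℂ)) (fun m => w (σ⁻¹ m))
    hij hik hil hjk hjl hkl
  rw [h1, h2, sub_zero] at hdiff
  have hchord : ((a i - a j : ℝ) : ℂ) * (w (σ⁻¹ i) - w (σ⁻¹ j))
      + ((a k - a l : ℝ) : ℂ) * (w (σ⁻¹ k) - w (σ⁻¹ l)) = 0 := by
    push_cast
    exact hdiff.symm
  rcases mul_eq_mul_or_eq_zero_of_chord_combination (hnorm _) (hnorm _) (hnorm _) (hnorm _)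
    (hinj hij) (hinj hkl) hchord with h | ⟨hα, hβ⟩
  · left
    have hpow : ζ ^ ((σ⁻¹ i : ℕ) + (σ⁻¹ j : ℕ)) = ζ ^ ((σ⁻¹ k : ℕ) + (σ⁻¹ l : ℕ)) := by
      refine mul_right_cancel₀ (pow_ne_zero 2 (hprim.ne_zero hp.ne_zero)) ?_
      simp only [hw] at h
      linear_combination h
    rwa [(hprim.isOfFinOrder hp.ne_zero).pow_inj_mod, ← hprim.eq_orderOf] at hpow
  · exact Or.inr ⟨sub_eq_zero.mp hα, sub_eq_zero.mp hβ⟩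
end

section
/- Let p be a prime, let π ∈ S_p be a p-cycle, and let G be a subgroup of S_p containing π and contained in the normalizer N_{S_p}(⟨π⟩) of the cyclic subgroup generated by π. Let W ⊆ ℂ^p be a nonzero complex linear subspace invariant under the permutation action of G, such that W is irreducible (its only G-invariant subspaces are 0 and W) and G does not act trivially on W. Then dim_ℂ W = |G|/p. -/
/-- The action of permutations on functions by permuting coordinates. -/
def permRep (ι : Type*) : Equiv.Perm ι →* Module.End ℂ (ι → ℂ) where
  toFun g := LinearMap.funLeft ℂ ℂ (g⁻¹ : Equiv.Perm ι)
  map_one' := by ext; simp [LinearMap.funLeft_apply]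
  map_mul' g h := by
    refine LinearMap.ext fun x => funext fun m => ?_
    simp [LinearMap.funLeft_apply, mul_inv_rev]

theorem permRep_apply {ι : Type*} (g : Equiv.Perm ι) (x : ι → ℂ) :
    permRep ι g x = fun m => x (g⁻¹ m) := rfl

theorem exists_zpow_apply_eq_of_support_eq_univ {ι : Type*} [Fintype ι] [DecidableEq ι]
    {π : Equiv.Perm ι} (hπ : π.IsCycle) (hs : π.support = Finset.univ) (a b : ι) :
    ∃ i : ℤ, (π ^ i) a = b := by
  refine hπ.exists_zpow_eq ?_ ?_ <;> rw [← Equiv.Perm.mem_support, hs] <;> exact Finset.mem_univ _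

/-- A permutation commuting with a full cycle is a power of it. -/
theorem mem_zpowers_of_commute_of_support_eq_univ {ι : Type*} [Fintype ι] [DecidableEq ι]
    {π c : Equiv.Perm ι} (hπ : π.IsCycle) (hs : π.support = Finset.univ) (hc : Commute c π) :
    c ∈ Subgroup.zpowers π := by
  obtain ⟨a, -⟩ := id hπ
  obtain ⟨i, hi⟩ := exists_zpow_apply_eq_of_support_eq_univ hπ hs a (c a)
  refine ⟨i, Equiv.ext fun b => ?_⟩
  obtain ⟨j, rfl⟩ := exists_zpow_apply_eq_of_support_eq_univ hπ hs a b
  have h1 : c ((π ^ j) a) = (π ^ j) (c a) := by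
    rw [← Equiv.Perm.mul_apply, (hc.zpow_right j).eq, Equiv.Perm.mul_apply]
  change (π ^ i) _ = _
  rw [h1, ← hi, ← Equiv.Perm.mul_apply, ← Equiv.Perm.mul_apply, ← zpow_add, ← zpow_add, add_comm]

/-- Fixed vectors of a full cycle are constant. -/
theorem permRep_eq_self_of_fixed {ι : Type*} [Fintype ι] [DecidableEq ι]
    {π : Equiv.Perm ι} (hπ : π.IsCycle) (hs : π.support = Finset.univ) {v : ι → ℂ}
    (hv : permRep ι π v = v) (g : Equiv.Perm ι) : permRep ι g v = v := by
  have step (m : ι) : v (π⁻¹ m) = v m := congrFun hv m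
  have hz (i : ℤ) : ∀ m, v ((π ^ i) m) = v m := by
    induction i using Int.induction_on with
    | zero => simp
    | succ i ih =>
      intro m
      rw [zpow_add_one, Equiv.Perm.mul_apply, ih, ← step (π m), ← Equiv.Perm.mul_apply,
        inv_mul_cancel, Equiv.Perm.one_apply]
    | pred i ih =>
      intro m
      rw [zpow_sub_one, Equiv.Perm.mul_apply, ih, step]
  funext m
  obtain ⟨i, hi⟩ := exists_zpow_apply_eq_of_support_eq_univ hπ hs m (g⁻¹ m)
  rw [← hz i m, hi, permRep_apply]

theorem permRep_pow_apply {ι : Type*} {π : Equiv.Perm ι} {v : ι → ℂ} {μ : ℂ}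
    (hv : permRep ι π v = μ • v) (k : ℕ) : permRep ι (π ^ k) v = μ ^ k • v := by
  induction k with
  | zero => simp
  | succ k ih => rw [pow_succ, map_mul, Module.End.mul_apply, hv, map_smul, ih, smul_smul, pow_succ']

/-- An element normalizing `⟨π⟩` maps eigenvectors of `π` to eigenvectors of `π`. -/
theorem permRep_permRep_of_conj_eq {ι : Type*} {π g : Equiv.Perm ι} {v : ι → ℂ} {μ : ℂ}
    (hv : permRep ι π v = μ • v) {k : ℕ} (hk : π ^ k = g⁻¹ * π * g) :
    permRep ι π (permRep ι g v) = μ ^ k • permRep ι g v := by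
  have h : π * g = g * π ^ k := by rw [hk]; group
  rw [← Module.End.mul_apply, ← map_mul, h, map_mul, Module.End.mul_apply,
    permRep_pow_apply hv, map_smul]

theorem permRep_apply_ne_zero {ι : Type*} {v : ι → ℂ} (hv : v ≠ 0) (g : Equiv.Perm ι) :
    permRep ι g v ≠ 0 := by
  intro h
  apply hv
  rw [← Module.End.one_apply (R := ℂ) v, ← map_one (permRep ι), ← inv_mul_cancel g, map_mul,
    Module.End.mul_apply, h, map_zero]


/-- Let `p` be prime, `π ∈ Sₚ` a `p`-cycle, and `G` a subgroup of `Sₚ`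
containing `π` and contained in the normalizer of `⟨π⟩`. Let `W ⊆ ℂ^p` be a nonzero
`G`-invariant subspace that is irreducible and on which `G` does not act trivially. Then
`dim_ℂ W = |G| / p`. -/
theorem stmt14 (p : ℕ) (hp : p.Prime)
    (π : Equiv.Perm (Fin p)) (hπ : π.IsCycle) (hπsupp : π.support = Finset.univ)
    (G : Subgroup (Equiv.Perm (Fin p))) (hπG : π ∈ G)
    (hGnorm : G ≤ Subgroup.normalizer (Subgroup.zpowers π))
    (W : Submodule ℂ (Fin p → ℂ)) (hW : W ≠ ⊥)
    (hWinv : ∀ g ∈ G, ∀ x ∈ W, (fun m => x (g⁻¹ m)) ∈ W)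
    (hirr : ∀ W' : Submodule ℂ (Fin p → ℂ), W' ≤ W →
      (∀ g ∈ G, ∀ x ∈ W', (fun m => x (g⁻¹ m)) ∈ W') → W' = ⊥ ∨ W' = W)
    (hnontriv : ∃ g ∈ G, ∃ x ∈ W, (fun m => x (g⁻¹ m)) ≠ x) :
    Module.finrank ℂ W = Nat.card G / p := by
  classical
  let ρ := permRep (Fin p)
  have hord : orderOf π = p := by rw [hπ.orderOf, hπsupp]; simp
  -- an eigenvector of `π` in `W`
  obtain ⟨v, μ, hvW, hv0, hv⟩ : ∃ v, ∃ μ : ℂ, v ∈ W ∧ v ≠ 0 ∧ ρ π v = μ • v := by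
    have : Nontrivial W := Submodule.nontrivial_iff_ne_bot.2 hW
    obtain ⟨μ, hμ⟩ := Module.End.exists_eigenvalue ((ρ π).restrict (hWinv π hπG))
    obtain ⟨v, hv⟩ := hμ.exists_hasEigenvector
    exact ⟨v, μ, v.2, fun h => hv.2 (Subtype.ext h), congrArg Subtype.val hv.apply_eq_smul⟩
  -- `W` is spanned by the orbit of `v`
  have hspan : Submodule.span ℂ (Set.range fun g : G => ρ g v) = W := by
    refine (hirr _ ?_ ?_).resolve_left ?_
    · rw [Submodule.span_le]
      rintro _ ⟨g, rfl⟩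
      exact hWinv g g.2 v hvW
    · intro g hg x hx
      change x ∈ (Submodule.span ℂ (Set.range fun g : G => ρ g v)).comap (ρ g)
      refine Submodule.span_le.2 ?_ hx
      rintro _ ⟨h, rfl⟩
      refine Submodule.subset_span ⟨⟨g, hg⟩ * h, ?_⟩
      simp
    · intro h
      rw [Submodule.span_eq_bot] at h
      exact permRep_apply_ne_zero hv0 _ (h _ ⟨1, rfl⟩)
  have hμ1 : μ ≠ 1 := by
    rintro rfl
    rw [one_smul] at hv
    have hfix := permRep_eq_self_of_fixed hπ hπsupp hv
    obtain ⟨g, -, x, hx, hne⟩ := hnontriv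
    refine hne ?_
    change x ∈ LinearMap.eqLocus (ρ g) LinearMap.id
    rw [← hspan] at hx
    refine Submodule.span_le.2 ?_ hx
    rintro _ ⟨h, rfl⟩
    simp [ρ, hfix]
  have hμord : orderOf μ = p := by
    have := Fact.mk hp
    refine orderOf_eq_prime ?_ hμ1
    have h := permRep_pow_apply hv p
    rw [orderOf_dvd_iff_pow_eq_one.1 hord.dvd, map_one, Module.End.one_apply] at h
    by_contra hne
    have h2 : (μ ^ p - 1) • v = 0 := by rw [sub_smul, ← h, one_smul, sub_self]
    exact (smul_ne_zero (sub_ne_zero.2 hne) hv0) h2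
  have hconj (g : G) : ∃ k : ℕ, π ^ k = (g : Equiv.Perm (Fin p))⁻¹ * π * g := by
    have h := (Subgroup.mem_normalizer_iff''.1 (hGnorm g.2) π).1 (Subgroup.mem_zpowers π)
    exact (mem_powers_iff_mem_zpowers.2 h)
  choose k hk using hconj
  let Q := G ⧸ (Subgroup.zpowers π).subgroupOf G
  let b : Q → Fin p → ℂ := fun q => ρ q.out v
  have hli : LinearIndependent ℂ b := by
    refine Module.End.eigenvectors_linearIndependent' (ρ π) (fun q : Q => μ ^ k q.out) ?_ b ?_
    · intro q r hqr
      have h1 : π ^ k q.out = π ^ k r.out := by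
        rw [pow_eq_pow_iff_modEq, hord.trans hμord.symm,
          ← (orderOf_pos_iff.1 (hμord ▸ hp.pos)).pow_eq_pow_iff_modEq]
        exact hqr
      rw [hk, hk] at h1
      rw [← Quotient.out_eq' q, ← Quotient.out_eq' r]
      refine QuotientGroup.eq.2 ?_
      generalize q.out = g at h1
      generalize r.out = h at h1
      obtain ⟨g, hg⟩ := g
      obtain ⟨h, hh⟩ := h
      have hc : Commute (h * g⁻¹) π := by
        have h2 : h * (g⁻¹ * π * g) * g⁻¹ = h * (h⁻¹ * π * h) * g⁻¹ := congrArg (h * · * g⁻¹) h1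
        simpa [Commute, SemiconjBy, mul_assoc] using h2
      have h3 := (Subgroup.mem_normalizer_iff''.1 (hGnorm hg) _).1
        (mem_zpowers_of_commute_of_support_eq_univ hπ hπsupp hc)
      rw [Subgroup.mem_subgroupOf]
      simpa [mul_assoc] using h3
    · intro q
      exact Module.End.hasEigenvector_iff.2 ⟨Module.End.mem_eigenspace_iff.2
        (permRep_permRep_of_conj_eq hv (hk _)), permRep_apply_ne_zero hv0 _⟩
  have hb : Submodule.span ℂ (Set.range b) = W := by
    rw [← hspan]
    refine le_antisymm (Submodule.span_mono ?_) (Submodule.span_le.2 ?_)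
    · rintro _ ⟨q, rfl⟩
      exact ⟨q.out, rfl⟩
    · rintro _ ⟨g, rfl⟩
      have h1 : (((g : Q).out)⁻¹ * g : G) ∈ (Subgroup.zpowers π).subgroupOf G :=
        QuotientGroup.eq.1 (Quotient.out_eq' (g : Q))
      obtain ⟨j, hj⟩ := mem_powers_iff_mem_zpowers.2 (Subgroup.mem_subgroupOf.1 h1)
      have h2 : (g : Equiv.Perm (Fin p)) = ((g : Q).out : G) * π ^ j := by
        change π ^ j = _ at hj
        rw [hj]; simp
      have h3 : ρ g v = μ ^ j • b (g : Q) := by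
        rw [h2, map_mul, Module.End.mul_apply, permRep_pow_apply hv, map_smul]
      change ρ g v ∈ _
      rw [h3]
      exact Submodule.smul_mem _ _ (Submodule.subset_span ⟨_, rfl⟩)
  have hcard : Nat.card G = Nat.card Q * p := by
    have hsub : Nat.card ((Subgroup.zpowers π).subgroupOf G) = p := by
      rw [Nat.card_congr (Subgroup.subgroupOfEquivOfLe
        (Subgroup.zpowers_le.2 hπG)).toEquiv, Nat.card_zpowers, hord]
    rw [Subgroup.card_eq_card_quotient_mul_card_subgroup ((Subgroup.zpowers π).subgroupOf G), hsub]
  rw [hcard, Nat.mul_div_cancel _ hp.pos, ← hb, finrank_span_eq_card hli, Nat.card_eq_fintype_card]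
end

section
/- Let p and m be positive integers with p ≥ 2m+1, and set κ = (p−2m)² − 1. Let Γ be a finite simple graph with V ≥ 1 vertices and e edges, and suppose e > (p−2m+1)·V/2. Then there exists a vertex C₀ of Γ such that Σ_{D adjacent to C₀} deg(D) ≥ κ + 2·deg(C₀), where deg denotes the degree of a vertex in Γ. -/
/-- Summing the degrees of the neighbors over all vertices gives the sum of squared degrees. -/
theorem SimpleGraph.sum_sum_degree_neighborFinset {V : Type*} [Fintype V]
    (G : SimpleGraph V) [DecidableRel G.Adj] :
    ∑ v, ∑ w ∈ G.neighborFinset v, G.degree w = ∑ w, G.degree w ^ 2 := by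
  rw [Finset.sum_comm' (t' := Finset.univ) (s' := fun w => G.neighborFinset w)
    (by simp [G.adj_comm])]
  simp [sq]


/-- Let `p, m` be positive integers with `p ≥ 2m + 1` and set
`κ = (p - 2m)² - 1`. Let `Γ` be a finite simple graph on a nonempty vertex set `V` with `e`
edges, and suppose `e > (p - 2m + 1)·|V|/2` (equivalently `2e > (p - 2m + 1)·|V|`). Then there
is a vertex `C₀` with `∑_{D ~ C₀} deg(D) ≥ κ + 2·deg(C₀)`. -/
theorem stmt15 (p m : ℕ) (hm : 0 < m) (hpm : 2 * m + 1 ≤ p)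
    (V : Type*) [Fintype V] [Nonempty V]
    (Γ : SimpleGraph V) [DecidableRel Γ.Adj]
    (he : (p - 2 * m + 1) * Fintype.card V < 2 * Γ.edgeFinset.card) :
    ∃ C₀ : V, ((p - 2 * m) ^ 2 - 1) + 2 * Γ.degree C₀ ≤
      ∑ D ∈ Γ.neighborFinset C₀, Γ.degree D := by
  by_contra! h
  have hq : 1 ≤ p - 2 * m := by omega
  generalize p - 2 * m = q at *
  have hlt : ∑ v, Γ.degree v ^ 2 < ∑ v, (q ^ 2 - 1 + 2 * Γ.degree v) := by
    rw [← Γ.sum_sum_degree_neighborFinset]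
    exact Finset.sum_lt_sum_of_nonempty Finset.univ_nonempty fun v _ => h v
  rw [← Γ.sum_degrees_eq_twice_card_edges] at he
  have htangent : ∑ v, (2 * ((q : ℤ) + 1) * Γ.degree v - (q + 1) ^ 2) ≤
      ∑ v, (Γ.degree v : ℤ) ^ 2 :=
    Finset.sum_le_sum fun v _ => by nlinarith [sq_nonneg ((Γ.degree v : ℤ) - (q + 1))]
  zify [Nat.one_le_pow 2 q hq] at hlt he
  simp only [Finset.sum_sub_distrib, Finset.sum_add_distrib, ← Finset.mul_sum,
    Finset.sum_const, Finset.card_univ, nsmul_eq_mul] at hlt htangent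
  have hq' : (1 : ℤ) ≤ q := by exact_mod_cast hq
  nlinarith
end

section
/- Let p ≥ 3 be a prime, let ζ = e^{2πi/p} ∈ ℂ, and let i₀, k₀ be integers with i₀ ≢ k₀ (mod p). For integers j with j ≢ 2k₀ − i₀ (mod p), the denominator ζ^{k₀} − ζ^{i₀ + j − k₀} is nonzero, and the function f(j) = (ζ^{i₀} − ζ^{j}) / (ζ^{k₀} − ζ^{i₀ + j − k₀}) is injective modulo p: if j and j' both satisfy j, j' ≢ 2k₀ − i₀ (mod p) and f(j) = f(j'), then j ≡ j' (mod p). -/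
/-- Let `p ≥ 3` be prime, `ζ = e^{2πi/p}`, and let `i₀, k₀` be integers with
`i₀ ≢ k₀ (mod p)`. For integers `j` with `j ≢ 2k₀ - i₀ (mod p)`, the denominator
`ζ^{k₀} - ζ^{i₀ + j - k₀}` is nonzero, and `f(j) = (ζ^{i₀} - ζ^j)/(ζ^{k₀} - ζ^{i₀+j-k₀})` is
injective modulo `p`. -/
theorem stmt16 (p : ℕ) (hp : p.Prime) (hp3 : 3 ≤ p)
    (ζ : ℂ) (hζ : ζ = Complex.exp (2 * Real.pi * Complex.I / p))
    (i₀ k₀ : ℤ) (hik : ¬ i₀ ≡ k₀ [ZMOD (p : ℤ)]) :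
    (∀ j : ℤ, ¬ j ≡ 2 * k₀ - i₀ [ZMOD (p : ℤ)] → ζ ^ k₀ - ζ ^ (i₀ + j - k₀) ≠ 0) ∧
    (∀ j j' : ℤ, ¬ j ≡ 2 * k₀ - i₀ [ZMOD (p : ℤ)] → ¬ j' ≡ 2 * k₀ - i₀ [ZMOD (p : ℤ)] →
      (ζ ^ i₀ - ζ ^ j) / (ζ ^ k₀ - ζ ^ (i₀ + j - k₀)) =
        (ζ ^ i₀ - ζ ^ j') / (ζ ^ k₀ - ζ ^ (i₀ + j' - k₀)) →
      j ≡ j' [ZMOD (p : ℤ)]) := by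
  have hprim : IsPrimitiveRoot ζ p := hζ ▸ Complex.isPrimitiveRoot_exp p hp.ne_zero
  have hζ0 : ζ ≠ 0 := hprim.ne_zero hp.ne_zero
  have zpow_inj (a b : ℤ) (h : ζ ^ a = ζ ^ b) : a ≡ b [ZMOD (p : ℤ)] := by
    refine (Int.modEq_iff_dvd.mpr ((hprim.zpow_eq_one_iff_dvd _).mp ?_))
    rw [zpow_sub₀ hζ0, h, div_self (zpow_ne_zero _ hζ0)]
  have hden (j : ℤ) (hj : ¬ j ≡ 2 * k₀ - i₀ [ZMOD (p : ℤ)]) :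
      ζ ^ k₀ - ζ ^ (i₀ + j - k₀) ≠ 0 := by
    intro h
    apply hj
    have hdvd := (zpow_inj _ _ (sub_eq_zero.mp h)).symm.dvd
    rw [Int.modEq_iff_dvd]
    convert hdvd using 1
    ring
  refine ⟨hden, fun j j' hj hj' h => zpow_inj _ _ ?_⟩
  have hsq : (ζ ^ i₀) ^ 2 - (ζ ^ k₀) ^ 2 ≠ 0 := by
    intro h0
    have hpow : ζ ^ (i₀ * 2) = ζ ^ (k₀ * 2) := by
      rw [zpow_mul, zpow_mul]
      exact_mod_cast sub_eq_zero.mp h0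
    have hdvd := (zpow_inj _ _ hpow).dvd
    rw [← sub_mul] at hdvd
    rcases (Nat.prime_iff_prime_int.mp hp).dvd_or_dvd hdvd with h1 | h1
    · exact hik (Int.modEq_iff_dvd.mpr h1)
    · have := Int.le_of_dvd two_pos h1
      omega
  have hK : ζ ^ k₀ ≠ 0 := zpow_ne_zero _ hζ0
  rw [div_eq_div_iff (hden j hj) (hden j' hj')] at h
  simp only [zpow_sub₀ hζ0, zpow_add₀ hζ0] at h
  field_simp at h
  refine sub_eq_zero.mp ((mul_eq_zero.mp ?_).resolve_right hsq)
  linear_combination h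
end

section
/- Let p be a prime, let ζ ∈ ℂ be a primitive p-th root of unity, and let a, b be integers with a ≢ b (mod p). Then the function g(x) = (1 − ζ^{a+x}) / (1 − ζ^{b+x}), defined for integers x with x ≢ −b (mod p) (so that the denominator is nonzero), is injective modulo p: if x, x' ≢ −b (mod p) and g(x) = g(x'), then x ≡ x' (mod p). -/
/-- Integer powers of a primitive `k`-th root of unity agree only at exponents congruent mod `k`. -/
theorem IsPrimitiveRoot.modEq_of_zpow_eq {K : Type*} [Field K] {ζ : K} {k : ℕ}
    (hζ : IsPrimitiveRoot ζ k) (hζ0 : ζ ≠ 0) {m n : ℤ} (h : ζ ^ m = ζ ^ n) :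
    m ≡ n [ZMOD (k : ℤ)] := by
  rw [Int.modEq_comm, Int.modEq_iff_dvd, ← hζ.zpow_eq_one_iff_dvd, zpow_sub₀ hζ0, h]
  exact div_self (zpow_ne_zero _ hζ0)

/-- Let `p` be prime, `ζ ∈ ℂ` a primitive `p`-th root of unity, and `a, b`
integers with `a ≢ b (mod p)`. Then `g(x) = (1 - ζ^{a+x})/(1 - ζ^{b+x})`, defined for integers
`x` with `x ≢ -b (mod p)` (so the denominator is nonzero), is injective modulo `p`. -/
theorem stmt17 (p : ℕ) (hp : p.Prime)
    (ζ : ℂ) (hζ : IsPrimitiveRoot ζ p)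
    (a b : ℤ) (hab : ¬ a ≡ b [ZMOD (p : ℤ)]) :
    (∀ x : ℤ, ¬ x ≡ -b [ZMOD (p : ℤ)] → 1 - ζ ^ (b + x) ≠ 0) ∧
    (∀ x x' : ℤ, ¬ x ≡ -b [ZMOD (p : ℤ)] → ¬ x' ≡ -b [ZMOD (p : ℤ)] →
      (1 - ζ ^ (a + x)) / (1 - ζ ^ (b + x)) = (1 - ζ ^ (a + x')) / (1 - ζ ^ (b + x')) →
      x ≡ x' [ZMOD (p : ℤ)]) := by
  have hζ0 : ζ ≠ 0 := hζ.ne_zero hp.ne_zero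
  have hden : ∀ x : ℤ, ¬ x ≡ -b [ZMOD (p : ℤ)] → 1 - ζ ^ (b + x) ≠ 0 := by
    intro x hx h
    refine hx (Int.ModEq.symm (Int.modEq_iff_dvd.2 ?_))
    have hdvd := (hζ.zpow_eq_one_iff_dvd (b + x)).1 (sub_eq_zero.1 h).symm
    rwa [sub_neg_eq_add, add_comm]
  refine ⟨hden, fun x x' hx hx' h => hζ.modEq_of_zpow_eq hζ0 ?_⟩
  rw [div_eq_div_iff (hden x hx) (hden x' hx')] at h
  simp only [zpow_add₀ hζ0] at h
  have hprod : (ζ ^ a - ζ ^ b) * (ζ ^ x - ζ ^ x') = 0 := by linear_combination -h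
  have hne : ζ ^ a - ζ ^ b ≠ 0 := fun h0 => hab (hζ.modEq_of_zpow_eq hζ0 (sub_eq_zero.1 h0))
  exact sub_eq_zero.1 ((mul_eq_zero.1 hprod).resolve_left hne)
end
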